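/- Let p ≥ 1 and let n_1, …, n_p, r_1, …, r_p be non-negative integers such that r_i ≥ r_{i+1} + n_{i+1} + 1 for every i ∈ {1, …, p−1}. Let P ∈ ℚ[k_1, …, k_p] with deg_{k_i} P ≤ 3n_i + 1 for every i, and let σ_1, …, σ_p ∈ {2, 3} be such that P(k_1, …, k_{i−1}, −k_i − 2r_i − n_i, k_{i+1}, …, k_p) = (−1)^{n_i+1+σ_i} P(k_1, …, k_p) for every i ∈ {1, …, p}. Then there exist a ℚ-linear combination L of multiple zeta values ζ(s_1, …, s_q) with q ≤ p − 1 and all s_i ∈ {2, 3}, and a rational number c, such that Σ_{k_1 ≥ … ≥ k_p ≥ 1} P(k_1, …, k_p) / ((k_1+r_1)_{n_1+1}^3 ⋯ (k_p+r_p)_{n_p+1}^3) = L + c · ζ(σ_1, …, σ_p); in other words, ζ(σ_1, …, σ_p) is the only multiple zeta value of depth p needed in the linear combination. -/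

import Mathlib

/-- The multiple zeta value `ζ(s₁, …, s_q)`, defined as a sum over strictly
decreasing tuples `k₁ > k₂ > … > k_q ≥ 1`.  For the empty list it equals `1`. -/
noncomputable def mzv (s : List ℕ) : ℝ :=
  ∑' k : {k : Fin s.length → ℕ // StrictAnti k ∧ ∀ i, 1 ≤ k i},
    ∏ i : Fin s.length, ((k.1 i : ℝ) ^ s.get i)⁻¹

open Finset Filter Topology Asymptotics

/-! ### Nested sums over weakly decreasing tuples -/

/-- The linear operator sending `u` to the partial sums `N ↦ ∑_{k ≤ N} f k * u k`. -/
noncomputable def sumMul (f : ℕ → ℝ) : (ℕ → ℝ) →ₗ[ℚ] (ℕ → ℝ) where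
  toFun u N := ∑ k ∈ range (N + 1), f k * u k
  map_add' u v := by
    ext N
    simp [mul_add, sum_add_distrib]
  map_smul' c u := by
    ext N
    simp only [Pi.smul_apply, RingHom.id_apply, Rat.smul_def, mul_sum]
    exact sum_congr rfl fun _ _ => by ring

lemma sumMul_apply (f u : ℕ → ℝ) (N : ℕ) :
    sumMul f u N = ∑ k ∈ range (N + 1), f k * u k := rfl

/-- The sum of `∏ i, f i (k i)` over the tuples `N ≥ k 0 ≥ k 1 ≥ ⋯`. -/
noncomputable def nestedSum : (p : ℕ) → (Fin p → ℕ → ℝ) → ℕ → ℝ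
  | 0, _ => 1
  | p + 1, f => sumMul (f 0) (nestedSum p fun i => f i.succ)

lemma antitone_cons_iff {p : ℕ} (x : ℕ) (k : Fin p → ℕ) :
    Antitone (Fin.cons x k : Fin (p + 1) → ℕ) ↔ Antitone k ∧ ∀ i, k i ≤ x := by
  constructor
  · intro h
    refine ⟨fun i j hij => ?_, fun i => ?_⟩
    · simpa using h (Fin.succ_le_succ_iff.mpr hij)
    · simpa using h (Fin.zero_le i.succ)
  · rintro ⟨h, hx⟩ i j hij
    induction i using Fin.cases with
    | zero =>
      induction j using Fin.cases with
      | zero => simp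
      | succ j => simpa using hx j
    | succ i =>
      induction j using Fin.cases with
      | zero => simp at hij
      | succ j => simpa using h (Fin.succ_le_succ_iff.mp hij)

open Classical in
lemma nestedSum_eq_sum (p : ℕ) (f : Fin p → ℕ → ℝ) (N : ℕ) :
    nestedSum p f N =
      ∑ k ∈ (Fintype.piFinset fun _ : Fin p => range (N + 1)) with Antitone k,
        ∏ i, f i (k i) := by
  induction p generalizing N with
  | zero =>
    rw [filter_true_of_mem fun k _ => Subsingleton.antitone k]
    simp [nestedSum]
  | succ p ih =>
    simp only [nestedSum, sumMul_apply, ih, mul_sum]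
    rw [sum_sigma']
    refine sum_bij' (fun x _ => (Fin.cons x.1 x.2 : Fin (p + 1) → ℕ))
      (fun k _ => ⟨k 0, Fin.tail k⟩) ?_ ?_ ?_ ?_ ?_
    · rintro ⟨x, k⟩ h
      simp only [mem_sigma, mem_range, mem_filter, Fintype.mem_piFinset] at h ⊢
      refine ⟨fun i => ?_, (antitone_cons_iff _ _).mpr ⟨h.2.2, fun i => ?_⟩⟩
      · induction i using Fin.cases with
        | zero => simpa using h.1
        | succ i =>
          have := h.2.1 i
          simp only [Fin.cons_succ]
          omega
      · have := h.2.1 i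
        omega
    · intro k h
      simp only [mem_sigma, mem_range, mem_filter, Fintype.mem_piFinset] at h ⊢
      have h2 := h.2
      rw [← Fin.cons_self_tail k, antitone_cons_iff] at h2
      exact ⟨h.1 0, fun i => Nat.lt_succ_of_le (h2.2 i), h2.1⟩
    · rintro ⟨x, k⟩ _
      simp
    · intro k _
      simp
    · rintro ⟨x, k⟩ _
      simp [Fin.prod_univ_succ]

lemma summable_prod_pi {p : ℕ} (f : Fin p → ℕ → ℝ) (hf : ∀ i, Summable (f i)) :
    Summable fun k : Fin p → ℕ => ∏ i, f i (k i) := by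
  induction p with
  | zero => exact (hasSum_fintype _).summable
  | succ p ih =>
    have h := summable_mul_of_summable_norm (hf 0).norm (ih (fun i => f i.succ) fun i => hf _).norm
    rw [← (Fin.consEquiv fun _ => ℕ).summable_iff]
    refine h.congr fun x => ?_
    simp [Fin.consEquiv, Fin.prod_univ_succ]

lemma summable_antitone {p : ℕ} (f : Fin p → ℕ → ℝ) (hf : ∀ i, Summable (f i)) :
    Summable fun k : {k : Fin p → ℕ // Antitone k} => ∏ i, f i (k.1 i) :=
  (summable_prod_pi f hf).subtype _

open Classical in
lemma tendsto_nestedSum {p : ℕ} (f : Fin p → ℕ → ℝ) (hf : ∀ i, Summable (f i)) :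
    Tendsto (nestedSum p f) atTop
      (𝓝 (∑' k : {k : Fin p → ℕ // Antitone k}, ∏ i, f i (k.1 i))) := by
  have h1 := (summable_antitone f hf).hasSum
  have h2 := (hasSum_subtype_iff_indicator (f := fun k : Fin p → ℕ => ∏ i, f i (k i))
    (s := {k | Antitone k})).mp h1
  have h3 : Tendsto (fun N : ℕ => Fintype.piFinset fun _ : Fin p => range (N + 1)) atTop atTop := by
    refine tendsto_atTop_finset_of_monotone (fun M N h => ?_) fun k => ?_
    · exact Fintype.piFinset_subset _ _ fun _ => range_subset_range.mpr (by omega)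
    · refine ⟨univ.sup k, ?_⟩
      simp only [Fintype.mem_piFinset, mem_range]
      exact fun i => Nat.lt_succ_of_le (le_sup (f := k) (mem_univ i))
  refine (h2.comp h3).congr fun N => ?_
  rw [nestedSum_eq_sum, sum_filter]
  exact sum_congr rfl fun k _ => by simp [Set.indicator_apply]

/-- Shifting the `i`-th entry by `p - i` turns weakly decreasing tuples of natural numbers into
strictly decreasing tuples of positive integers. -/
noncomputable def antitoneEquivStrictAnti (p : ℕ) :
    {k : Fin p → ℕ // Antitone k} ≃ {k : Fin p → ℕ // StrictAnti k ∧ ∀ i, 1 ≤ k i} where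
  toFun k := ⟨fun i => k.1 i + (p - i), fun i j hij => by
      have := k.2 hij.le
      have := j.2
      have : i.1 < j.1 := hij
      dsimp only
      omega, fun i => by
      show 1 ≤ k.1 i + (p - i)
      have := i.2
      omega⟩
  invFun k := ⟨fun i => k.1 i - (p - i), by
      rcases p with _ | p
      · exact Subsingleton.antitone _
      · refine Fin.antitone_iff_succ_le.mpr fun i => ?_
        have := k.2.1 (Fin.castSucc_lt_succ (i := i))
        simp only [Fin.val_succ, Fin.val_castSucc]
        omega⟩
  left_inv k := by
    ext i
    simp
  right_inv k := by
    have key : ∀ m, ∀ i : Fin p, p - i = m → m ≤ k.1 i := by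
      intro m
      induction m with
      | zero => intro i _; exact Nat.zero_le _
      | succ m ih =>
        intro i hi
        by_cases hm : m = 0
        · subst hm
          exact k.2.2 i
        · have hlt : i.1 + 1 < p := by omega
          have h1 := ih ⟨i.1 + 1, hlt⟩ (by simp only; omega)
          have h2 := k.2.1 (show i < ⟨i.1 + 1, hlt⟩ from Nat.lt_succ_self _)
          omega
    ext i
    have := key _ i rfl
    simp only
    omega

/-- Adding one to every entry. -/
def antitoneEquivPos (p : ℕ) :
    {k : Fin p → ℕ // Antitone k} ≃ {k : Fin p → ℕ // Antitone k ∧ ∀ i, 1 ≤ k i} where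
  toFun k := ⟨fun i => k.1 i + 1, fun i j hij => Nat.succ_le_succ (k.2 hij),
    fun i => Nat.le_add_left 1 (k.1 i)⟩
  invFun k := ⟨fun i => k.1 i - 1, fun i j hij => Nat.sub_le_sub_right (k.2.1 hij) 1⟩
  left_inv k := by
    ext i
    simp
  right_inv k := by
    ext i
    have := k.2.2 i
    simp only
    omega

/-! ### Inverse powers of shifted variables -/

/-- The sequence `k ↦ 1 / (k + 1 + j) ^ s`. -/
noncomputable def shiftPow (j s : ℕ) (k : ℕ) : ℝ := (((k : ℝ) + 1 + j) ^ s)⁻¹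

/-- The truncated multiple zeta value, written as a nested sum over weakly decreasing tuples. -/
noncomputable def truncMzv : List ℕ → ℕ → ℝ
  | [] => 1
  | s :: w => sumMul (shiftPow w.length s) (truncMzv w)

lemma summable_shiftPow (j s : ℕ) (hs : 2 ≤ s) : Summable (shiftPow j s) := by
  have h := (summable_nat_add_iff (j + 1)).mpr (Real.summable_nat_pow_inv.mpr hs)
  refine h.congr fun k => ?_
  simp only [shiftPow]
  push_cast
  ring_nf

lemma truncMzv_eq_nestedSum (w : List ℕ) :
    truncMzv w = nestedSum w.length fun i => shiftPow (w.length - 1 - i) (w.get i) := by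
  induction w with
  | nil => rfl
  | cons s w ih =>
    simp only [truncMzv, nestedSum, List.length_cons, ih]
    congr 3
    funext i
    congr 1
    simp only [Fin.val_succ]
    omega

lemma tendsto_truncMzv (w : List ℕ) (hw : ∀ a ∈ w, 2 ≤ a) :
    Tendsto (truncMzv w) atTop (𝓝 (mzv w)) := by
  have h := tendsto_nestedSum (fun i : Fin w.length => shiftPow (w.length - 1 - i) (w.get i))
    fun i => summable_shiftPow _ _ (hw _ (w.get_mem i))
  rw [← truncMzv_eq_nestedSum] at h
  convert h using 2
  rw [mzv, ← (antitoneEquivStrictAnti w.length).tsum_eq]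
  refine tsum_congr fun k => prod_congr rfl fun i _ => ?_
  have : ((w.length - i.1 : ℕ) : ℝ) = 1 + ((w.length - 1 - i.1 : ℕ) : ℝ) := by
    have := i.2
    norm_cast
    omega
  simp only [antitoneEquivStrictAnti, Equiv.coe_fn_mk, shiftPow]
  push_cast
  rw [this, add_assoc]

lemma shiftPow_nonneg (j s k : ℕ) : 0 ≤ shiftPow j s k := by
  unfold shiftPow
  positivity

lemma shiftPow_le (j s t k : ℕ) (hts : t ≤ s) : shiftPow j s k ≤ shiftPow 0 t k := by
  unfold shiftPow
  have h0 : (0 : ℝ) ≤ k := k.cast_nonneg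
  have hj : (0 : ℝ) ≤ j := j.cast_nonneg
  refine inv_anti₀ (by positivity) ?_
  calc ((k : ℝ) + 1 + (0 : ℕ)) ^ t ≤ ((k : ℝ) + 1 + j) ^ t := by
        gcongr
        exact Nat.zero_le j
    _ ≤ ((k : ℝ) + 1 + j) ^ s := pow_le_pow_right₀ (by linarith) hts

lemma shiftPow_isBigO (j s t : ℕ) (hts : t ≤ s) : shiftPow j s =O[atTop] shiftPow 0 t := by
  refine IsBigO.of_bound 1 (Eventually.of_forall fun k => ?_)
  rw [Real.norm_of_nonneg (shiftPow_nonneg _ _ _), Real.norm_of_nonneg (shiftPow_nonneg _ _ _),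
    one_mul]
  exact shiftPow_le j s t k hts

lemma shiftPow_zero_right (j : ℕ) : shiftPow j 0 = 1 := by
  ext k
  simp [shiftPow]

lemma tendsto_shiftPow (j s : ℕ) (hs : 1 ≤ s) : Tendsto (shiftPow j s) atTop (𝓝 0) := by
  have h : Tendsto (fun k : ℕ => 1 / ((k : ℝ) + 1)) atTop (𝓝 0) :=
    tendsto_one_div_add_atTop_nhds_zero_nat
  refine squeeze_zero (fun k => shiftPow_nonneg j s k) (fun k => ?_) h
  refine (shiftPow_le j s 1 k hs).trans_eq ?_
  simp [shiftPow]

/-- The rational span of the functions `((v + j) ^ s)⁻¹` with `lo ≤ j < a` and `s ≤ 3`. -/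
noncomputable def poleSpan {ι : Type*} (v : ι → ℝ) (lo a : ℕ) : Submodule ℚ (ι → ℝ) :=
  Submodule.span ℚ {h | ∃ j s : ℕ, lo ≤ j ∧ j < a ∧ s ≤ 3 ∧ h = fun i => ((v i + j) ^ s)⁻¹}

section poleSpan

variable {ι : Type*} (v : ι → ℝ)

lemma inv_pow_mem_poleSpan {lo a j s : ℕ} (hlo : lo ≤ j) (ha : j < a) (hs : s ≤ 3) :
    (fun i => ((v i + j) ^ s)⁻¹) ∈ poleSpan v lo a :=
  Submodule.subset_span ⟨j, s, hlo, ha, hs, rfl⟩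

lemma poleSpan_mono {lo a lo' a' : ℕ} (hlo : lo' ≤ lo) (ha : a ≤ a') :
    poleSpan v lo a ≤ poleSpan v lo' a' := by
  refine Submodule.span_mono ?_
  rintro _ ⟨j, s, h1, h2, hs, rfl⟩
  exact ⟨j, s, hlo.trans h1, h2.trans_le ha, hs, rfl⟩

lemma inv_pow_mul_inv_pow_mem {lo a j j' : ℕ} (hlo : lo ≤ j) (hjj : j < j') (ha : j' < a)
    (hv : ∀ i, ∀ j, lo ≤ j → j < a → v i + j ≠ 0) (s t : ℕ) (hs : s ≤ 3) (ht : t ≤ 3) :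
    (fun i => ((v i + j) ^ s)⁻¹ * ((v i + j') ^ t)⁻¹) ∈ poleSpan v lo a := by
  induction s generalizing t with
  | zero => simpa using inv_pow_mem_poleSpan v (hlo.trans hjj.le) ha ht
  | succ s ihs =>
    induction t with
    | zero => simpa using inv_pow_mem_poleSpan v hlo (hjj.trans ha) hs
    | succ t iht =>
      have key := (poleSpan v lo a).smul_mem (((j' : ℚ) - j)⁻¹)
        ((poleSpan v lo a).sub_mem (iht (by omega)) (ihs (t + 1) (by omega) ht))
      convert key using 1
      ext i
      have h1 := hv i j hlo (hjj.trans ha)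
      have h2 := hv i j' (hlo.trans hjj.le) ha
      have h3 : (j' : ℝ) - j ≠ 0 := sub_ne_zero.mpr (by exact_mod_cast hjj.ne')
      simp only [Pi.smul_apply, Pi.sub_apply, Rat.smul_def, Rat.cast_inv, Rat.cast_sub,
        Rat.cast_natCast]
      field_simp
      ring

lemma mul_mem_poleSpan {lo a b b' : ℕ} {f g : ι → ℝ} (hb : b ≤ b')
    (hv : ∀ i, ∀ j, lo ≤ j → j < a → v i + j ≠ 0)
    (hf : f ∈ poleSpan v lo b) (hg : g ∈ poleSpan v b' a) : f * g ∈ poleSpan v lo a := by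
  have h := Submodule.mul_mem_mul hf hg
  rw [poleSpan, poleSpan, Submodule.span_mul_span] at h
  refine Submodule.span_le.mpr ?_ h
  rintro _ ⟨_, ⟨j, s, h1, h2, hs, rfl⟩, _, ⟨j', t, h1', h2', ht, rfl⟩, rfl⟩
  exact inv_pow_mul_inv_pow_mem v h1 (by omega) h2' hv s t hs ht

lemma pow_mul_inv_pow_mem {j : ℕ} (hv : ∀ i, v i + j ≠ 0) (e s : ℕ) (hes : e ≤ s) (hs : s ≤ 3) :
    (fun i => v i ^ e * ((v i + j) ^ s)⁻¹) ∈ poleSpan v j (j + 1) := by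
  induction e generalizing s with
  | zero => simpa using inv_pow_mem_poleSpan v le_rfl (Nat.lt_succ_self j) hs
  | succ e ih =>
    obtain ⟨s, rfl⟩ : ∃ t, s = t + 1 := ⟨s - 1, by omega⟩
    have key := (poleSpan v j (j + 1)).sub_mem (ih s (by omega) (by omega))
      ((poleSpan v j (j + 1)).smul_mem (j : ℚ) (ih (s + 1) (by omega) hs))
    convert key using 1
    ext i
    have h1 := hv i
    simp only [Pi.smul_apply, Pi.sub_apply, Rat.smul_def, Rat.cast_natCast]
    field_simp
    ring

lemma pow_div_prod_mem_poleSpan (r n e : ℕ) (he : e ≤ 3 * (n + 1))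
    (hv : ∀ i, ∀ j, r ≤ j → j < r + n + 1 → v i + j ≠ 0) :
    (fun i => v i ^ e / (∏ j ∈ range (n + 1), (v i + r + j)) ^ 3) ∈
      poleSpan v r (r + n + 1) := by
  induction n generalizing e with
  | zero =>
    have h := pow_mul_inv_pow_mem v (j := r) (fun i => hv i r le_rfl (by omega)) e 3 (by omega)
      le_rfl
    convert h using 2
    simp [div_eq_mul_inv]
  | succ n ih =>
    have h1 := ih (e - min e 3) (by omega) fun i j h h' => hv i j h (by omega)
    have h2 := pow_mul_inv_pow_mem v (j := r + n + 1) (fun i => hv i _ (by omega) (by omega))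
      (min e 3) 3 (by omega) le_rfl
    convert mul_mem_poleSpan v le_rfl hv h1 h2 using 1
    ext i
    rw [Pi.mul_apply, prod_range_succ _ (n + 1), mul_pow, div_eq_mul_inv, div_eq_mul_inv, mul_inv]
    have : v i ^ e = v i ^ (e - min e 3) * v i ^ min e 3 := by
      rw [← pow_add]
      congr 1
      omega
    rw [this]
    push_cast
    simp only [add_assoc]
    ring

end poleSpan

/-- The space `poleSpan` for sequences. -/
noncomputable abbrev seqSpan (lo a : ℕ) : Submodule ℚ (ℕ → ℝ) :=
  poleSpan (fun k : ℕ => (k : ℝ) + 1) lo a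

lemma shiftPow_mem {lo a j s : ℕ} (hlo : lo ≤ j) (ha : j < a) (hs : s ≤ 3) :
    shiftPow j s ∈ seqSpan lo a :=
  inv_pow_mem_poleSpan _ hlo ha hs

lemma seq_mul_mem {lo a b b' : ℕ} {f g : ℕ → ℝ} (hb : b ≤ b') (hf : f ∈ seqSpan lo b)
    (hg : g ∈ seqSpan b' a) : f * g ∈ seqSpan lo a :=
  mul_mem_poleSpan _ hb (fun i j _ _ => by positivity) hf hg

/-- The shift operator on sequences. -/
noncomputable def seqShift : (ℕ → ℝ) →ₗ[ℚ] (ℕ → ℝ) := LinearMap.funLeft ℚ ℝ Nat.succ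

lemma seqShift_apply (f : ℕ → ℝ) (k : ℕ) : seqShift f k = f (k + 1) := rfl

lemma seqShift_shiftPow (j s : ℕ) : seqShift (shiftPow j s) = shiftPow (j + 1) s := by
  ext k
  simp only [seqShift_apply, shiftPow]
  push_cast
  ring_nf

lemma isBigO_zero_seq (g : ℕ → ℝ) : (0 : ℕ → ℝ) =O[atTop] g := isBigO_zero _ _

lemma isBigO_smul_rat {f g : ℕ → ℝ} (c : ℚ) (h : f =O[atTop] g) : (c • f) =O[atTop] g := by
  have : c • f = fun k => (c : ℝ) * f k := by
    ext k
    simp [Rat.smul_def]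
  rw [this]
  exact h.const_mul_left _

lemma isBigO_one_of_mem {lo a : ℕ} {f : ℕ → ℝ} (hf : f ∈ seqSpan lo a) :
    f =O[atTop] (1 : ℕ → ℝ) := by
  induction hf using Submodule.span_induction with
  | mem x h =>
    obtain ⟨j, s, -, -, -, rfl⟩ := h
    have := shiftPow_isBigO j s 0 (Nat.zero_le _)
    rwa [shiftPow_zero_right] at this
  | zero => exact isBigO_zero _ _
  | add x y _ _ hx hy => exact hx.add hy
  | smul c x _ hx => exact isBigO_smul_rat c hx

lemma isBigO_diff_shiftPow (j s : ℕ) :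
    (seqShift (shiftPow j s) - shiftPow j s) =O[atTop] shiftPow 0 2 := by
  rw [seqShift_shiftPow]
  induction s with
  | zero =>
    rw [shiftPow_zero_right, shiftPow_zero_right, sub_self]
    exact isBigO_zero_seq _
  | succ s ih =>
    have h1 : shiftPow (j + 1) (s + 1) - shiftPow j (s + 1) =
        (shiftPow (j + 1) s - shiftPow j s) * shiftPow j 1 -
          shiftPow (j + 1) (s + 1) * shiftPow j 1 := by
      ext k
      simp only [Pi.sub_apply, Pi.mul_apply, shiftPow]
      have : (k : ℝ) + 1 + j ≠ 0 := by positivity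
      have : (k : ℝ) + 1 + (j + 1 : ℕ) ≠ 0 := by positivity
      field_simp
      push_cast
      ring
    have h2 : shiftPow 0 2 = shiftPow 0 1 * shiftPow 0 1 := by
      ext k
      simp only [Pi.mul_apply, shiftPow, ← mul_inv]
      ring_nf
    rw [h1]
    refine IsBigO.sub ?_ ?_
    · have := ih.mul (shiftPow_isBigO j 1 0 (Nat.zero_le _))
      rw [shiftPow_zero_right] at this
      exact this.congr_right fun k => mul_one _
    · rw [h2]
      exact (shiftPow_isBigO (j + 1) (s + 1) 1 (by omega)).mul (shiftPow_isBigO j 1 1 le_rfl)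

lemma isBigO_diff {lo a : ℕ} {f : ℕ → ℝ} (hf : f ∈ seqSpan lo a) :
    (seqShift f - f) =O[atTop] shiftPow 0 2 := by
  induction hf using Submodule.span_induction with
  | mem x h =>
    obtain ⟨j, s, -, -, -, rfl⟩ := h
    exact isBigO_diff_shiftPow j s
  | zero =>
    rw [map_zero, sub_zero]
    exact isBigO_zero_seq _
  | add x y _ _ hx hy =>
    have := hx.add hy
    rw [map_add, add_sub_add_comm]
    exact this
  | smul c x _ hx =>
    rw [map_smul, ← smul_sub]
    exact isBigO_smul_rat c hx

/-- The sequences converging to an element of `T`. -/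
def limIn (T : Submodule ℚ ℝ) : Submodule ℚ (ℕ → ℝ) where
  carrier := {u | ∃ x ∈ T, Tendsto u atTop (𝓝 x)}
  add_mem' := by
    rintro u v ⟨x, hx, hux⟩ ⟨y, hy, hvy⟩
    exact ⟨x + y, T.add_mem hx hy, hux.add hvy⟩
  zero_mem' := ⟨0, T.zero_mem, tendsto_const_nhds⟩
  smul_mem' := by
    rintro c u ⟨x, hx, hux⟩
    refine ⟨c • x, T.smul_mem c hx, ?_⟩
    rw [Rat.smul_def]
    exact (hux.const_mul (c : ℝ)).congr fun k => by simp [Rat.smul_def]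

lemma mem_limIn {T : Submodule ℚ ℝ} {u : ℕ → ℝ} :
    u ∈ limIn T ↔ ∃ x ∈ T, Tendsto u atTop (𝓝 x) := Iff.rfl

lemma mem_limIn_bot {u : ℕ → ℝ} : u ∈ limIn ⊥ ↔ Tendsto u atTop (𝓝 0) := by
  simp [mem_limIn]

lemma limIn_mono {T T' : Submodule ℚ ℝ} (h : T ≤ T') : limIn T ≤ limIn T' :=
  fun _ ⟨x, hx, hu⟩ => ⟨x, h hx, hu⟩

/-- The forward differences of null sequences `G` such that both `G` and its shift have poles
in the given range. -/
noncomputable def diffSpan (lo a : ℕ) : Submodule ℚ (ℕ → ℝ) :=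
  (seqSpan lo a ⊓ (seqSpan lo a).comap seqShift ⊓ limIn ⊥).map (seqShift - LinearMap.id)

lemma mem_diffSpan {lo a : ℕ} {h : ℕ → ℝ} : h ∈ diffSpan lo a ↔
    ∃ G ∈ seqSpan lo a, seqShift G ∈ seqSpan lo a ∧ Tendsto G atTop (𝓝 0) ∧
      h = seqShift G - G := by
  simp only [diffSpan, Submodule.mem_map, Submodule.mem_inf, Submodule.mem_comap, mem_limIn_bot]
  constructor
  · rintro ⟨G, ⟨⟨h1, h2⟩, h3⟩, rfl⟩
    exact ⟨G, h1, h2, h3, rfl⟩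
  · rintro ⟨G, h1, h2, h3, rfl⟩
    exact ⟨G, ⟨⟨h1, h2⟩, h3⟩, rfl⟩

lemma isBigO_of_mem_diffSpan {lo a : ℕ} {h : ℕ → ℝ} (hh : h ∈ diffSpan lo a) :
    h =O[atTop] shiftPow 0 2 := by
  obtain ⟨G, hG, -, -, rfl⟩ := mem_diffSpan.mp hh
  exact isBigO_diff hG

lemma diffSpan_le (lo a : ℕ) : diffSpan lo a ≤ seqSpan lo a := by
  intro h hh
  obtain ⟨G, hG, hG', -, rfl⟩ := mem_diffSpan.mp hh
  exact Submodule.sub_mem _ hG' hG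

lemma shiftPow_sub_mem_diffSpan {lo a j s : ℕ} (hlo : lo ≤ j) (ha : j < a) (hs : s ≤ 3) :
    shiftPow j s - shiftPow lo s ∈ diffSpan lo a := by
  rcases Nat.eq_zero_or_pos s with rfl | hs0
  · simp [shiftPow_zero_right]
  · induction j, hlo using Nat.le_induction with
    | base => simp
    | succ j hj ih =>
      have h1 : shiftPow (j + 1) s - shiftPow j s ∈ diffSpan lo a := by
        refine mem_diffSpan.mpr ⟨shiftPow j s, shiftPow_mem hj (by omega) hs, ?_,
          tendsto_shiftPow j s hs0, ?_⟩ <;> rw [seqShift_shiftPow]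
        exact shiftPow_mem (by omega) ha hs
      simpa using Submodule.add_mem _ h1 (ih (by omega))

/-- Combinations of the functions `shiftPow lo s`, `s ∈ S`, up to forward differences. -/
noncomputable def nearSpan (lo a : ℕ) (S : Finset ℕ) : Submodule ℚ (ℕ → ℝ) :=
  Submodule.span ℚ (shiftPow lo '' S) ⊔ diffSpan lo a

lemma mem_nearSpan {lo a : ℕ} {S : Finset ℕ} {f : ℕ → ℝ} : f ∈ nearSpan lo a S ↔
    ∃ c : ℕ → ℚ, ∃ h ∈ diffSpan lo a, f = ∑ s ∈ S, c s • shiftPow lo s + h := by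
  rw [nearSpan, Submodule.mem_sup]
  constructor
  · rintro ⟨y, hy, h, hh, rfl⟩
    obtain ⟨c, rfl⟩ := Submodule.mem_span_image_finset_iff_exists_fun ℚ |>.mp hy
    refine ⟨fun s => if hs : s ∈ S then c ⟨s, hs⟩ else 0, h, hh, ?_⟩
    rw [← sum_coe_sort S]
    congr 1
    exact sum_congr rfl fun s _ => by simp
  · rintro ⟨c, h, hh, rfl⟩
    exact ⟨_, Submodule.sum_smul_mem _ _ fun s hs =>
      Submodule.subset_span (Set.mem_image_of_mem _ hs), h, hh, rfl⟩

lemma shiftPow_mem_nearSpan {lo a j s : ℕ} {S : Finset ℕ} (hlo : lo ≤ j) (ha : j < a) (hs : s ≤ 3)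
    (hS : s ∈ S) : shiftPow j s ∈ nearSpan lo a S := by
  have h1 : shiftPow lo s ∈ nearSpan lo a S :=
    Submodule.mem_sup_left (Submodule.subset_span (Set.mem_image_of_mem _ hS))
  have h2 : shiftPow j s - shiftPow lo s ∈ nearSpan lo a S :=
    Submodule.mem_sup_right (shiftPow_sub_mem_diffSpan hlo ha hs)
  simpa using Submodule.add_mem _ h2 h1

lemma nearSpan_le {lo a : ℕ} {S : Finset ℕ} (hlo : lo < a) (hS : ∀ s ∈ S, s ≤ 3) :
    nearSpan lo a S ≤ seqSpan lo a := by
  refine sup_le (Submodule.span_le.mpr ?_) (diffSpan_le lo a)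
  rintro _ ⟨s, hs, rfl⟩
  exact shiftPow_mem le_rfl hlo (hS s hs)

lemma isBigO_sum_shiftPow (c : ℕ → ℚ) (lo t : ℕ) (S : Finset ℕ) (hS : ∀ s ∈ S, t ≤ s) :
    (∑ s ∈ S, c s • shiftPow lo s) =O[atTop] shiftPow 0 t := by
  induction S using Finset.induction_on with
  | empty => exact isBigO_zero_seq _
  | insert s S hs ih =>
    rw [sum_insert hs]
    exact (isBigO_smul_rat _ (shiftPow_isBigO lo s t (hS s (mem_insert_self s S)))).add
      (ih fun s h => hS s (mem_insert_of_mem h))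

lemma isBigO_of_mem_nearSpan {lo a : ℕ} {S : Finset ℕ} {f : ℕ → ℝ} (hS : ∀ s ∈ S, 2 ≤ s)
    (hf : f ∈ nearSpan lo a S) : f =O[atTop] shiftPow 0 2 := by
  obtain ⟨c, h, hh, rfl⟩ := mem_nearSpan.mp hf
  exact (isBigO_sum_shiftPow c lo 2 S hS).add (isBigO_of_mem_diffSpan hh)

lemma mem_nearSpan_of_isBigO {lo a : ℕ} {S : Finset ℕ} {f : ℕ → ℝ} (hS : ∀ s ∈ S, 2 ≤ s)
    (hf : f ∈ nearSpan lo a (insert 0 (insert 1 S))) (hO : f =O[atTop] shiftPow 0 2) :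
    f ∈ nearSpan lo a S := by
  obtain ⟨c, h, hh, rfl⟩ := mem_nearSpan.mp hf
  have h1 : (1 : ℕ) ∉ S := fun h => absurd (hS 1 h) (by omega)
  have h0 : (0 : ℕ) ∉ insert 1 S := by
    rw [mem_insert]
    rintro (h | h)
    · omega
    · exact absurd (hS 0 h) (by omega)
  rw [sum_insert h0, sum_insert h1] at hO ⊢
  have hrest := (isBigO_sum_shiftPow c lo 2 S hS).add (isBigO_of_mem_diffSpan hh)
  have hO2 : (c 0 • shiftPow lo 0 + c 1 • shiftPow lo 1) =O[atTop] shiftPow 0 2 := by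
    refine (hO.sub hrest).congr_left fun k => ?_
    simp only [Pi.add_apply]
    ring
  have hc0 : c 0 = 0 := by
    have h3 := hO2.trans_tendsto (tendsto_shiftPow 0 2 (by omega))
    have h4 : Tendsto (c 0 • shiftPow lo 0 + c 1 • shiftPow lo 1) atTop
        (𝓝 (((c 0 : ℚ) : ℝ) + c 1 * 0)) := by
      have := ((tendsto_shiftPow lo 1 le_rfl).const_mul ((c 1 : ℚ) : ℝ)).const_add ((c 0 : ℚ) : ℝ)
      refine this.congr fun k => ?_
      simp [shiftPow_zero_right, Rat.smul_def]
    have := tendsto_nhds_unique h4 h3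
    simpa using this
  have hc1 : c 1 = 0 := by
    rw [hc0, zero_smul, zero_add] at hO2
    have h3 : (fun k : ℕ => (k : ℝ) + 1 + lo) =O[atTop] fun k : ℕ => (k : ℝ) + 1 := by
      refine IsBigO.of_bound (1 + lo) (Eventually.of_forall fun k => ?_)
      rw [Real.norm_of_nonneg (by positivity), Real.norm_of_nonneg (by positivity)]
      have : (0 : ℝ) ≤ k * lo := by positivity
      linarith
    have h4 : (fun _ : ℕ => ((c 1 : ℚ) : ℝ)) =O[atTop] shiftPow 0 1 := by
      refine (hO2.mul h3).congr (fun k => ?_) (fun k => ?_)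
      · have : (k : ℝ) + 1 + lo ≠ 0 := by positivity
        simp only [Pi.smul_apply, Rat.smul_def, shiftPow]
        field_simp
      · simp only [shiftPow]
        have : (k : ℝ) + 1 ≠ 0 := by positivity
        push_cast
        field_simp
        ring
    have := tendsto_nhds_unique tendsto_const_nhds
      (h4.trans_tendsto (tendsto_shiftPow 0 1 le_rfl))
    simpa using this
  rw [hc0, hc1, zero_smul, zero_smul, zero_add, zero_add]
  exact mem_nearSpan.mpr ⟨c, h, hh, rfl⟩

lemma seqSpan_le_nearSpan (lo a : ℕ) :
    seqSpan lo a ≤ nearSpan lo a (insert 0 (insert 1 {2, 3})) := by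
  refine Submodule.span_le.mpr ?_
  rintro _ ⟨j, s, h1, h2, hs, rfl⟩
  refine shiftPow_mem_nearSpan h1 h2 hs ?_
  interval_cases s <;> simp

lemma mem_nearSpan_of_mem_seqSpan {lo a : ℕ} {f : ℕ → ℝ} (hf : f ∈ seqSpan lo a)
    (hO : f =O[atTop] shiftPow 0 2) : f ∈ nearSpan lo a {2, 3} :=
  mem_nearSpan_of_isBigO (by simp) (seqSpan_le_nearSpan lo a hf) hO

lemma sumMul_comm (f u : ℕ → ℝ) : sumMul f u = sumMul u f := by
  ext N
  simp only [sumMul_apply, mul_comm]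

lemma sumMul_mul (f g u : ℕ → ℝ) : sumMul f (g * u) = sumMul (f * g) u := by
  ext N
  simp only [sumMul_apply, Pi.mul_apply, mul_assoc]

lemma sumMul_diff_one (G : ℕ → ℝ) :
    sumMul (seqShift G - G) 1 = seqShift G - fun _ => G 0 := by
  ext N
  simp only [sumMul_apply, Pi.sub_apply, seqShift_apply, Pi.one_apply, mul_one]
  exact sum_range_sub G (N + 1)

lemma sumMul_diff_sumMul (G d u : ℕ → ℝ) :
    sumMul (seqShift G - G) (sumMul d u) = seqShift G * sumMul d u - sumMul (G * d) u := by
  ext N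
  simp only [sumMul_apply, Pi.sub_apply, Pi.mul_apply, seqShift_apply]
  induction N with
  | zero =>
    simp only [zero_add, sum_range_one]
    ring
  | succ N ih =>
    rw [sum_range_succ, ih, sum_range_succ (fun k => d k * u k) (N + 1),
      sum_range_succ (fun k => G k * d k * u k) (N + 1)]
    ring

lemma exists_rat_of_mem_seqSpan {lo a : ℕ} {G : ℕ → ℝ} (hG : G ∈ seqSpan lo a) :
    ∃ q : ℚ, G 0 = q := by
  induction hG using Submodule.span_induction with
  | mem x h =>
    obtain ⟨j, s, -, -, -, rfl⟩ := h
    exact ⟨((1 + j : ℚ) ^ s)⁻¹, by simp⟩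
  | zero => exact ⟨0, by simp⟩
  | add x y _ _ hx hy =>
    obtain ⟨p, hp⟩ := hx
    obtain ⟨q, hq⟩ := hy
    exact ⟨p + q, by simp [hp, hq]⟩
  | smul c x _ hx =>
    obtain ⟨p, hp⟩ := hx
    exact ⟨c * p, by simp [hp, Rat.smul_def]⟩

/-! ### Reduction of nested sums to multiple zeta values -/

/-- A factor of a nested sum: a sequence, an upper bound for its poles, and the exponents
which it may contribute in top depth. -/
abbrev NestedFactor := (ℕ → ℝ) × ℕ × Finset ℕ

/-- Apply the operators `sumMul` of the listed factors, the head of the list first. -/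
noncomputable def iterSum : List NestedFactor → (ℕ → ℝ) →ₗ[ℚ] (ℕ → ℝ)
  | [] => LinearMap.id
  | x :: t => iterSum t ∘ₗ sumMul x.1

/-- The factors have consecutive pole ranges starting at `lo`, and are congruent to combinations
of the allowed exponents modulo forward differences. -/
def Admissible : List NestedFactor → ℕ → Prop
  | [], _ => True
  | x :: t, lo => lo < x.2.1 ∧ x.2.2 ⊆ {2, 3} ∧ x.1 ∈ nearSpan lo x.2.1 x.2.2 ∧
      Admissible t x.2.1

/-- The exponent lists obtained by putting allowed exponents in front of `w`. -/
def topLists : List NestedFactor → List ℕ → Set (List ℕ)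
  | [], w => {w}
  | x :: t, w => ⋃ s ∈ x.2.2, topLists t (s :: w)

/-- The span of the multiple zeta values with exponents in `{2, 3}` and depth less than `m`. -/
noncomputable def shortSpan (m : ℕ) : Submodule ℚ ℝ :=
  Submodule.span ℚ (mzv '' {u | u.length < m ∧ ∀ a ∈ u, a = 2 ∨ a = 3})

/-- The values of smaller depth, together with those of top depth which are allowed. -/
noncomputable def targetSpan (t : List NestedFactor) (w : List ℕ) : Submodule ℚ ℝ :=
  shortSpan (t.length + w.length) ⊔ Submodule.span ℚ (mzv '' topLists t w)

lemma topLists_subset (t : List NestedFactor) (w : List ℕ) (lo : ℕ) (ht : Admissible t lo)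
    (hw : ∀ a ∈ w, a = 2 ∨ a = 3) :
    topLists t w ⊆ {u | u.length = t.length + w.length ∧ ∀ a ∈ u, a = 2 ∨ a = 3} := by
  induction t generalizing w lo with
  | nil =>
    rintro _ rfl
    simpa using hw
  | cons x t ih =>
    intro u hu
    simp only [topLists, Set.mem_iUnion] at hu
    obtain ⟨s, hs, hu⟩ := hu
    have hs' : s = 2 ∨ s = 3 := by simpa using ht.2.1 hs
    have := ih (s :: w) _ ht.2.2.2 (by simpa using ⟨hs', hw⟩) hu
    refine ⟨?_, this.2⟩
    rw [this.1]
    simp only [List.length_cons]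
    omega

lemma shortSpan_mono {m m' : ℕ} (h : m ≤ m') : shortSpan m ≤ shortSpan m' :=
  Submodule.span_mono (Set.image_mono fun _ hu => ⟨hu.1.trans_le h, hu.2⟩)

lemma targetSpan_le_shortSpan {t : List NestedFactor} {w : List ℕ} {lo m : ℕ}
    (ht : Admissible t lo) (hw : ∀ a ∈ w, a = 2 ∨ a = 3) (hm : t.length + w.length < m) :
    targetSpan t w ≤ shortSpan m := by
  refine sup_le (shortSpan_mono hm.le) (Submodule.span_mono (Set.image_mono fun u hu => ?_))
  obtain ⟨h1, h2⟩ := topLists_subset t w lo ht hw hu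
  exact ⟨by omega, h2⟩

lemma targetSpan_cons_le {x : NestedFactor} {t : List NestedFactor} {w : List ℕ} {s : ℕ}
    (hs : s ∈ x.2.2) : targetSpan t (s :: w) ≤ targetSpan (x :: t) w := by
  refine sup_le_sup (shortSpan_mono ?_) (Submodule.span_mono (Set.image_mono fun u hu => ?_))
  · simp only [List.length_cons]
    omega
  · exact Set.mem_biUnion hs hu

lemma Admissible.mem_seqSpan {x : NestedFactor} {t : List NestedFactor} {lo : ℕ}
    (h : Admissible (x :: t) lo) : x.1 ∈ seqSpan lo x.2.1 := by
  refine nearSpan_le h.1 (fun s hs => ?_) h.2.2.1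
  have : s = 2 ∨ s = 3 := by simpa using h.2.1 hs
  omega

lemma Admissible.isBigO {x : NestedFactor} {t : List NestedFactor} {lo : ℕ}
    (h : Admissible (x :: t) lo) : x.1 =O[atTop] shiftPow 0 2 := by
  refine isBigO_of_mem_nearSpan (fun s hs => ?_) h.2.2.1
  have : s = 2 ∨ s = 3 := by simpa using h.2.1 hs
  omega

lemma nearSpan_mono {lo lo' a : ℕ} {S : Finset ℕ} (hlo : lo' ≤ lo) (ha : lo < a)
    (hS : ∀ s ∈ S, s ≤ 3) : nearSpan lo a S ≤ nearSpan lo' a S := by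
  refine sup_le (Submodule.span_le.mpr ?_) fun h hh => Submodule.mem_sup_right ?_
  · rintro _ ⟨s, hs, rfl⟩
    exact shiftPow_mem_nearSpan hlo ha (hS s hs) hs
  · obtain ⟨G, hG, hG', hG0, rfl⟩ := mem_diffSpan.mp hh
    exact mem_diffSpan.mpr ⟨G, poleSpan_mono _ hlo le_rfl hG, poleSpan_mono _ hlo le_rfl hG',
      hG0, rfl⟩

lemma Admissible.mono {t : List NestedFactor} {lo lo' : ℕ} (h : Admissible t lo)
    (hlo : lo' ≤ lo) : Admissible t lo' := by
  cases t with
  | nil => trivial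
  | cons x t =>
    refine ⟨hlo.trans_lt h.1, h.2.1, nearSpan_mono hlo h.1 (fun s hs => ?_) h.2.2.1, h.2.2.2⟩
    have : s = 2 ∨ s = 3 := by simpa using h.2.1 hs
    omega

lemma Admissible.mul_head {x : NestedFactor} {t : List NestedFactor} {lo a : ℕ} {g : ℕ → ℝ}
    (h : Admissible (x :: t) a) (hlo : lo ≤ a) (hg : g ∈ seqSpan lo a) :
    Admissible ((x.1 * g, x.2.1, {2, 3}) :: t) lo := by
  refine ⟨hlo.trans_lt h.1, subset_rfl, mem_nearSpan_of_mem_seqSpan ?_ ?_, h.2.2.2⟩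
  · rw [mul_comm]
    exact seq_mul_mem le_rfl hg h.mem_seqSpan
  · exact (h.isBigO.mul (isBigO_one_of_mem hg)).congr_right fun k => mul_one _

/-- A nested sum starting with a forward difference has smaller depth. -/
lemma iterSum_diff_mem {t : List NestedFactor} {w : List ℕ} {a : ℕ} {h : ℕ → ℝ}
    (ih : ∀ (t' : List NestedFactor) (w' : List ℕ),
      t'.length + w'.length < t.length + w.length + 1 →
      Admissible t' w'.length → (∀ a ∈ w', a = 2 ∨ a = 3) →
      iterSum t' (truncMzv w') ∈ limIn (targetSpan t' w'))
    (hwa : w.length < a) (ht : Admissible t a) (hw : ∀ a ∈ w, a = 2 ∨ a = 3)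
    (hh : h ∈ diffSpan w.length a) :
    iterSum t (sumMul h (truncMzv w)) ∈ limIn (shortSpan (t.length + w.length + 1)) := by
  obtain ⟨G, hG, hG', hG0, rfl⟩ := mem_diffSpan.mp hh
  have ih' : ∀ (t' : List NestedFactor) (w' : List ℕ),
      t'.length + w'.length < t.length + w.length + 1 →
      Admissible t' w'.length → (∀ a ∈ w', a = 2 ∨ a = 3) →
      iterSum t' (truncMzv w') ∈ limIn (shortSpan (t.length + w.length + 1)) :=
    fun t' w' h1 h2 h3 => limIn_mono (targetSpan_le_shortSpan h2 h3 h1) (ih t' w' h1 h2 h3)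
  have hmain : iterSum t (seqShift G * truncMzv w) ∈
      limIn (shortSpan (t.length + w.length + 1)) := by
    cases t with
    | nil =>
      have h1 := tendsto_truncMzv w fun a ha => by
        have := hw a ha
        omega
      have h2 : Tendsto (seqShift G) atTop (𝓝 0) := (tendsto_add_atTop_iff_nat 1).mpr hG0
      have h12 := h2.mul h1
      refine ⟨0, Submodule.zero_mem _, ?_⟩
      rw [zero_mul] at h12
      exact h12
    | cons x t =>
      have := ih' ((x.1 * seqShift G, x.2.1, {2, 3}) :: t) w (by simp)
        (ht.mul_head hwa.le hG') hw
      simpa [iterSum, sumMul_mul] using this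
  cases w with
  | nil =>
    obtain ⟨q, hq⟩ := exists_rat_of_mem_seqSpan hG
    have hone : truncMzv [] = 1 := rfl
    have hconst : (fun _ : ℕ => G 0) = q • truncMzv [] := by
      ext k
      simp [hq, hone, Rat.smul_def]
    rw [hone, sumMul_diff_one, hconst, map_sub, map_smul]
    refine Submodule.sub_mem _ ?_ (Submodule.smul_mem _ _ ?_)
    · simpa [hone] using hmain
    · exact ih' t [] (by simp) (ht.mono (Nat.zero_le a)) (by simp)
  | cons s w =>
    have hs : s = 2 ∨ s = 3 := hw s List.mem_cons_self
    have hstep : truncMzv (s :: w) = sumMul (shiftPow w.length s) (truncMzv w) := rfl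
    rw [hstep, sumMul_diff_sumMul, map_sub]
    refine Submodule.sub_mem _ (by rwa [hstep] at hmain) ?_
    refine ih' ((G * shiftPow w.length s, a, {2, 3}) :: t) w
      (by simp only [List.length_cons]; omega) ⟨?_, subset_rfl, ?_, ht⟩
      fun b hb => hw b (List.mem_cons_of_mem _ hb)
    · simp only [List.length_cons] at hwa ⊢
      omega
    · refine mem_nearSpan_of_mem_seqSpan ?_ ?_
      · rw [mul_comm]
        exact seq_mul_mem le_rfl (shiftPow_mem le_rfl (Nat.lt_succ_self _) (by omega)) hG
      · refine ((isBigO_one_of_mem hG).mul (shiftPow_isBigO _ s 2 (by omega))).congr_right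
          fun k => one_mul _

theorem iterSum_mem_limIn (t : List NestedFactor) (w : List ℕ) (ht : Admissible t w.length)
    (hw : ∀ a ∈ w, a = 2 ∨ a = 3) :
    iterSum t (truncMzv w) ∈ limIn (targetSpan t w) := by
  obtain ⟨m, hm⟩ : ∃ m, t.length + w.length = m := ⟨_, rfl⟩
  induction m using Nat.strong_induction_on generalizing t w with
  | _ m ihm =>
    induction t generalizing w with
    | nil =>
      refine ⟨mzv w, Submodule.mem_sup_right (Submodule.subset_span ⟨w, rfl, rfl⟩),
        tendsto_truncMzv w fun a ha => ?_⟩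
      have := hw a ha
      omega
    | cons x t ih =>
      obtain ⟨hlo, hS, hx, ht⟩ := ht
      obtain ⟨c, h, hh, hxe⟩ := mem_nearSpan.mp hx
      have h1 : iterSum (x :: t) (truncMzv w) = ∑ s ∈ x.2.2, c s • iterSum t (truncMzv (s :: w)) +
          iterSum t (sumMul h (truncMzv w)) := by
        rw [iterSum, LinearMap.comp_apply, hxe, sumMul_comm, map_add, map_add, map_sum, map_sum,
          sumMul_comm _ h]
        congr 1
        refine sum_congr rfl fun s _ => ?_
        rw [map_smul, map_smul, sumMul_comm]
        rfl
      rw [h1]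
      simp only [List.length_cons] at hm
      refine Submodule.add_mem _ (Submodule.sum_smul_mem _ _ fun s hs => ?_) ?_
      · refine limIn_mono (targetSpan_cons_le hs) (ih (s :: w) ?_ ?_ ?_)
        · exact ht.mono hlo
        · simpa using ⟨by simpa using hS hs, hw⟩
        · simp only [List.length_cons]
          omega
      · refine limIn_mono (le_sup_of_le_left (shortSpan_mono ?_))
          (iterSum_diff_mem (fun t' w' h' ht' hw' => ihm _ (by omega) t' w' ht' hw' rfl)
            hlo ht hw hh)
        simp only [List.length_cons]
        omega

/-! ### Symmetric rational functions -/

/-- The symmetrization of `x ^ e / ((x + r) ⋯ (x + r + n)) ^ 3` at `x = k + 1`, of parity `σ` with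
respect to `x ↦ -x - 2 * r - n`. -/
noncomputable def symFactor (n r σ e : ℕ) (k : ℕ) : ℝ :=
  (((k : ℝ) + 1) ^ e + (-1) ^ (n + 1 + σ) * (-((k : ℝ) + 1) - 2 * r - n) ^ e) /
    (∏ j ∈ range (n + 1), ((k : ℝ) + 1 + r + j)) ^ 3

lemma prod_range_reflected (x r : ℝ) (n : ℕ) :
    ∏ j ∈ range (n + 1), (-x - 2 * r - n + r + j) =
      (-1) ^ (n + 1) * ∏ j ∈ range (n + 1), (x + r + j) := by
  have h : ∏ j ∈ range (n + 1), (-1 : ℝ) = (-1) ^ (n + 1) := by simp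
  rw [← h, ← prod_range_reflect (fun j : ℕ => x + r + (j : ℝ)), ← prod_mul_distrib]
  refine prod_congr rfl fun j hj => ?_
  have hj' : j ≤ n := Nat.lt_succ_iff.mp (mem_range.mp hj)
  rw [Nat.add_sub_cancel, Nat.cast_sub hj']
  ring

lemma symFactor_isBigO (n r σ e : ℕ) (he : e ≤ 3 * n + 1) :
    symFactor n r σ e =O[atTop] shiftPow 0 2 := by
  refine IsBigO.of_bound (1 + (1 + 2 * r + n) ^ e) (Eventually.of_forall fun k => ?_)
  have hx : (1 : ℝ) ≤ (k : ℝ) + 1 := by simp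
  have hden : ((k : ℝ) + 1) ^ (n + 1) ≤ ∏ j ∈ range (n + 1), ((k : ℝ) + 1 + r + j) := by
    calc ((k : ℝ) + 1) ^ (n + 1) = ∏ j ∈ range (n + 1), ((k : ℝ) + 1) := by simp
      _ ≤ _ := prod_le_prod (fun _ _ => by positivity) fun j _ => by
        have : (0 : ℝ) ≤ r := r.cast_nonneg
        have : (0 : ℝ) ≤ j := j.cast_nonneg
        linarith
  have hnum : |((k : ℝ) + 1) ^ e + (-1) ^ (n + 1 + σ) * (-((k : ℝ) + 1) - 2 * r - n) ^ e| ≤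
      (1 + (1 + 2 * r + n) ^ e) * ((k : ℝ) + 1) ^ e := by
    have h1 : |-((k : ℝ) + 1) - 2 * r - n| ≤ (1 + 2 * r + n) * ((k : ℝ) + 1) := by
      have e1 : -((k : ℝ) + 1) - 2 * r - n = -((k : ℝ) + 1 + 2 * r + n) := by ring
      rw [e1, abs_neg, abs_of_nonneg (by positivity)]
      have : (0 : ℝ) ≤ (2 * r + n) * k := by positivity
      linarith
    calc _ ≤ |((k : ℝ) + 1) ^ e| +
          |(-1) ^ (n + 1 + σ) * (-((k : ℝ) + 1) - 2 * r - n) ^ e| := abs_add_le _ _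
      _ = ((k : ℝ) + 1) ^ e + |-((k : ℝ) + 1) - 2 * r - n| ^ e := by
        rw [abs_mul, abs_pow, abs_pow, abs_pow, abs_neg, abs_one, one_pow, one_mul,
          abs_of_nonneg (by positivity : (0 : ℝ) ≤ (k : ℝ) + 1)]
      _ ≤ ((k : ℝ) + 1) ^ e + ((1 + 2 * r + n) * ((k : ℝ) + 1)) ^ e := by gcongr
      _ = _ := by
        rw [mul_pow]
        ring
  rw [Real.norm_of_nonneg (shiftPow_nonneg _ _ _), Real.norm_eq_abs, symFactor, abs_div,
    abs_of_nonneg (by positivity : (0 : ℝ) ≤ (∏ j ∈ range (n + 1), ((k : ℝ) + 1 + r + j)) ^ 3),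
    shiftPow, Nat.cast_zero, add_zero, ← div_eq_mul_inv,
    div_le_div_iff₀ (by positivity) (by positivity)]
  calc _ ≤ (1 + (1 + 2 * r + n) ^ e) * ((k : ℝ) + 1) ^ e * ((k : ℝ) + 1) ^ 2 := by gcongr
    _ = (1 + (1 + 2 * r + n) ^ e) * ((k : ℝ) + 1) ^ (e + 2) := by ring
    _ ≤ (1 + (1 + 2 * r + n) ^ e) * ((k : ℝ) + 1) ^ ((n + 1) * 3) := by
      gcongr
      omega
    _ = (1 + (1 + 2 * r + n) ^ e) * (((k : ℝ) + 1) ^ (n + 1)) ^ 3 := by rw [pow_mul]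
    _ ≤ _ := by gcongr

lemma symFactor_mem (n r σ e : ℕ) (he : e ≤ 3 * n + 1) (hσ : σ = 2 ∨ σ = 3) :
    symFactor n r σ e ∈ nearSpan r (r + n + 1) {σ} := by
  refine mem_nearSpan_of_isBigO (fun s hs => ?_) ?_ (symFactor_isBigO n r σ e he)
  · rw [mem_singleton.mp hs]
    omega
  let v : ℕ ⊕ ℕ → ℝ := Sum.elim (fun k => (k : ℝ) + 1) (fun k => -((k : ℝ) + 1) - 2 * r - n)
  let L : ((ℕ ⊕ ℕ) → ℝ) →ₗ[ℚ] (ℕ → ℝ) :=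
    LinearMap.funLeft ℚ ℝ Sum.inl + ((-1 : ℚ) ^ σ) • LinearMap.funLeft ℚ ℝ Sum.inr
  have hv : ∀ i, ∀ j : ℕ, r ≤ j → j < r + n + 1 → v i + j ≠ 0 := by
    rintro (k | k) j h1 h2
    · simp only [v, Sum.elim_inl]
      positivity
    · simp only [v, Sum.elim_inr]
      have : (j : ℝ) ≤ r + n := by
        norm_cast
        omega
      have : (0 : ℝ) ≤ k := k.cast_nonneg
      have : (0 : ℝ) ≤ r := r.cast_nonneg
      intro h
      linarith
  have hL : ∀ g ∈ poleSpan v r (r + n + 1),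
      L g ∈ nearSpan r (r + n + 1) (insert 0 (insert 1 {σ})) := by
    intro g hg
    induction hg using Submodule.span_induction with
    | mem x h =>
      obtain ⟨j, s, h1, h2, hs, rfl⟩ := h
      have hj : 2 * r + n - j < r + n + 1 := by omega
      have e1 : L (fun i => ((v i + j) ^ s)⁻¹) =
          shiftPow j s + ((-1 : ℚ) ^ (σ + s)) • shiftPow (2 * r + n - j) s := by
        ext k
        have e2 : v (Sum.inr k) + j = -((k : ℝ) + 1 + (2 * r + n - j : ℕ)) := by
          rw [Nat.cast_sub (by omega)]
          simp only [v, Sum.elim_inr]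
          push_cast
          ring
        simp only [L, LinearMap.add_apply, LinearMap.smul_apply, Pi.add_apply, Pi.smul_apply,
          LinearMap.funLeft_apply, e2, Rat.smul_def, shiftPow, v, Sum.elim_inl]
        rw [neg_pow ((k : ℝ) + 1 + (2 * r + n - j : ℕ)), mul_inv, ← inv_pow (-1 : ℝ), inv_neg,
          inv_one]
        push_cast
        rw [pow_add]
        ring
      rw [e1]
      rcases Nat.even_or_odd (σ + s) with hp | hp
      · rw [hp.neg_one_pow, one_smul]
        have hs' : s ∈ insert 0 (insert 1 ({σ} : Finset ℕ)) := by
          simp only [mem_insert, mem_singleton]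
          rcases hσ with rfl | rfl <;> interval_cases s <;> revert hp <;> decide
        exact Submodule.add_mem _ (shiftPow_mem_nearSpan h1 h2 hs hs')
          (shiftPow_mem_nearSpan (by omega) hj hs hs')
      · rw [hp.neg_one_pow, neg_smul, one_smul, ← sub_eq_add_neg]
        refine Submodule.mem_sup_right ?_
        rw [← sub_sub_sub_cancel_right _ _ (shiftPow r s)]
        exact Submodule.sub_mem _ (shiftPow_sub_mem_diffSpan h1 h2 hs)
          (shiftPow_sub_mem_diffSpan (by omega) hj hs)
    | zero => simp
    | add x y _ _ hx hy =>
      rw [map_add]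
      exact Submodule.add_mem _ hx hy
    | smul c x _ hx =>
      rw [map_smul]
      exact Submodule.smul_mem _ c hx
  convert hL _ (pow_div_prod_mem_poleSpan v r n e (by omega) hv) using 1
  ext k
  simp only [L, LinearMap.add_apply, LinearMap.smul_apply, Pi.add_apply, Pi.smul_apply,
    LinearMap.funLeft_apply, Rat.smul_def, v, Sum.elim_inl, Sum.elim_inr, symFactor]
  rw [prod_range_reflected, add_div, mul_pow]
  push_cast
  have h3 : ((-1 : ℝ) ^ (n + 1)) ^ 3 = (-1) ^ (n + 1) := by
    rcases neg_one_pow_eq_or ℝ (n + 1) with h | h <;> rw [h] <;> norm_num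
  have hprod : (∏ j ∈ range (n + 1), ((k : ℝ) + 1 + r + j)) ≠ 0 :=
    prod_ne_zero_iff.mpr fun j _ => by positivity
  rw [h3, pow_add]
  rcases neg_one_pow_eq_or ℝ (n + 1) with h | h <;> rw [h] <;> field_simp

lemma eval_piecewise_of_symm {p : ℕ} (P : MvPolynomial (Fin p) ℚ) (τ : Fin p → ℚ → ℚ)
    (ε : Fin p → ℚ)
    (hsym : ∀ i k, MvPolynomial.eval (Function.update k i (τ i (k i))) P =
      ε i * MvPolynomial.eval k P) (k : Fin p → ℚ) (t : Finset (Fin p)) :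
    MvPolynomial.eval (t.piecewise (fun i => τ i (k i)) k) P =
      (∏ i ∈ t, ε i) * MvPolynomial.eval k P := by
  induction t using Finset.induction_on with
  | empty => simp
  | insert i t hi ih =>
    rw [piecewise_insert, prod_insert hi, mul_assoc, ← ih, ← hsym, piecewise_eq_of_notMem _ _ _ hi]

lemma two_pow_mul_eval_of_symm {p : ℕ} (P : MvPolynomial (Fin p) ℚ) (τ : Fin p → ℚ → ℚ)
    (ε : Fin p → ℚ) (hε : ∀ i, ε i * ε i = 1)
    (hsym : ∀ i k, MvPolynomial.eval (Function.update k i (τ i (k i))) P =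
      ε i * MvPolynomial.eval k P) (k : Fin p → ℚ) :
    2 ^ p * MvPolynomial.eval k P =
      ∑ d ∈ P.support, P.coeff d * ∏ i, (k i ^ d i + ε i * τ i (k i) ^ d i) := by
  have h1 : ∀ t : Finset (Fin p), (∏ i ∈ t, ε i) *
      MvPolynomial.eval (t.piecewise (fun i => τ i (k i)) k) P = MvPolynomial.eval k P := by
    intro t
    rw [eval_piecewise_of_symm P τ ε hsym, ← mul_assoc, ← prod_mul_distrib,
      prod_congr rfl fun i _ => hε i, prod_const_one, one_mul]
  have h2 : 2 ^ p * MvPolynomial.eval k P = ∑ t : Finset (Fin p), (∏ i ∈ t, ε i) *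
      MvPolynomial.eval (t.piecewise (fun i => τ i (k i)) k) P := by
    rw [sum_congr rfl fun t _ => h1 t]
    simp
  rw [h2]
  simp only [MvPolynomial.eval_eq', mul_sum]
  rw [sum_comm]
  refine sum_congr rfl fun d _ => ?_
  rw [prod_congr rfl fun i _ => add_comm _ _, Fintype.prod_add, mul_sum]
  refine sum_congr rfl fun t _ => ?_
  have ha : ∏ i ∈ t, t.piecewise (fun i => τ i (k i)) k i ^ d i = ∏ i ∈ t, τ i (k i) ^ d i :=
    prod_congr rfl fun i hi => by rw [piecewise_eq_of_mem _ _ _ hi]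
  have hb : ∏ i ∈ tᶜ, t.piecewise (fun i => τ i (k i)) k i ^ d i = ∏ i ∈ tᶜ, k i ^ d i :=
    prod_congr rfl fun i hi => by rw [piecewise_eq_of_notMem _ _ _ (mem_compl.mp hi)]
  rw [prod_mul_distrib, ← prod_mul_prod_compl t fun i => t.piecewise (fun i => τ i (k i)) k i ^ d i,
    ha, hb]
  ring

/-! ### The list of factors of a product -/

/-- The list of factors attached to a tuple of sequences, the last one first. -/
def factorList (p : ℕ) (f : Fin p → ℕ → ℝ) (a σ : Fin p → ℕ) : List NestedFactor :=
  (List.ofFn fun i => (f i, a i, ({σ i} : Finset ℕ))).reverse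

lemma factorList_succ (p : ℕ) (f : Fin (p + 1) → ℕ → ℝ) (a σ : Fin (p + 1) → ℕ) :
    factorList (p + 1) f a σ = (f (Fin.last p), a (Fin.last p), {σ (Fin.last p)}) ::
      factorList p (fun i => f i.castSucc) (fun i => a i.castSucc) (fun i => σ i.castSucc) := by
  rw [factorList, List.ofFn_succ', List.concat_eq_append, List.reverse_append]
  rfl

lemma iterSum_append (l₁ l₂ : List NestedFactor) (u : ℕ → ℝ) :
    iterSum (l₁ ++ l₂) u = iterSum l₂ (iterSum l₁ u) := by
  induction l₁ generalizing u with
  | nil => rfl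
  | cons x l ih => simp [iterSum, ih]

lemma iterSum_factorList (p : ℕ) (f : Fin p → ℕ → ℝ) (a σ : Fin p → ℕ) :
    iterSum (factorList p f a σ) 1 = nestedSum p f := by
  induction p with
  | zero => rfl
  | succ p ih =>
    have h := ih (fun i => f i.succ) (fun i => a i.succ) (fun i => σ i.succ)
    rw [factorList, List.ofFn_succ, List.reverse_cons, iterSum_append]
    rw [factorList] at h
    rw [h]
    rfl

lemma admissible_factorList (p : ℕ) (f : Fin p → ℕ → ℝ) (n r : ℕ → ℕ) (σ : Fin p → ℕ) (lo : ℕ)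
    (hσ : ∀ i, σ i = 2 ∨ σ i = 3)
    (hf : ∀ i : Fin p, f i ∈ nearSpan (r i) (r i + n i + 1) {σ i})
    (hr : ∀ i, i + 1 < p → r (i + 1) + n (i + 1) + 1 ≤ r i) (hlo : ∀ i, i + 1 = p → lo ≤ r i) :
    Admissible (factorList p f (fun i => r i + n i + 1) σ) lo := by
  induction p generalizing lo with
  | zero => trivial
  | succ p ih =>
    rw [factorList_succ]
    have hlast := hlo p rfl
    refine ⟨?_, ?_, ?_, ?_⟩
    · simp only [Fin.val_last]
      omega
    · simpa using hσ (Fin.last p)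
    · refine nearSpan_mono hlast ?_ (fun s hs => ?_) (hf (Fin.last p))
      · simp only [Fin.val_last]
        omega
      · have := hσ (Fin.last p)
        rw [mem_singleton.mp hs]
        omega
    · refine ih _ _ _ (fun i => hσ _) (fun i => hf i.castSucc) (fun i hi => hr i (by omega))
        fun i hi => ?_
      subst hi
      exact hr i (Nat.lt_succ_self _)

lemma topLists_factorList (p : ℕ) (f : Fin p → ℕ → ℝ) (a σ : Fin p → ℕ) (w : List ℕ) :
    topLists (factorList p f a σ) w = {List.ofFn σ ++ w} := by
  induction p generalizing w with
  | zero => rfl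
  | succ p ih =>
    rw [factorList_succ, List.ofFn_succ']
    simp [topLists, ih]

lemma tsum_symFactor_mem (p : ℕ) (n r : ℕ → ℕ) (σ d : Fin p → ℕ)
    (hr : ∀ i, i + 1 < p → r (i + 1) + n (i + 1) + 1 ≤ r i)
    (hσ : ∀ i, σ i = 2 ∨ σ i = 3) (hd : ∀ i, d i ≤ 3 * n i + 1) :
    ∑' k : {k : Fin p → ℕ // Antitone k}, ∏ i : Fin p, symFactor (n i) (r i) (σ i) (d i) (k.1 i) ∈
      shortSpan p ⊔ Submodule.span ℚ {mzv (List.ofFn σ)} := by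
  set f : Fin p → ℕ → ℝ := fun i => symFactor (n i) (r i) (σ i) (d i) with hf
  have h1 := tendsto_nestedSum f fun i =>
    summable_of_isBigO_nat (summable_shiftPow 0 2 le_rfl) (symFactor_isBigO _ _ _ _ (hd i))
  obtain ⟨x, hx, hlim⟩ := iterSum_mem_limIn (factorList p f (fun i => r i + n i + 1) σ) []
    (admissible_factorList p f n r σ 0 hσ (fun i => symFactor_mem _ _ _ _ (hd i) (hσ i)) hr
      fun _ _ => Nat.zero_le _) (by simp)
  have h2 : truncMzv [] = 1 := rfl
  rw [h2, iterSum_factorList] at hlim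
  rw [tendsto_nhds_unique h1 hlim]
  rw [targetSpan, topLists_factorList] at hx
  simpa [factorList] using hx

lemma ascPochhammer_eval_eq_prod (n : ℕ) (x : ℝ) :
    (ascPochhammer ℝ n).eval x = ∏ j ∈ range n, (x + j) := by
  induction n with
  | zero => simp
  | succ n ih => rw [ascPochhammer_succ_eval, ih, prod_range_succ]

lemma exists_combination_of_mem {p : ℕ} {x : ℝ} {u : List ℕ}
    (hx : x ∈ shortSpan p ⊔ Submodule.span ℚ {mzv u}) :
    ∃ (T : Finset (List ℕ)) (c : List ℕ → ℚ) (cₚ : ℚ),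
      (∀ s ∈ T, s.length < p ∧ ∀ a ∈ s, a = 2 ∨ a = 3) ∧
      x = (∑ s ∈ T, (c s : ℝ) * mzv s) + (cₚ : ℝ) * mzv u := by
  obtain ⟨y, hy, z, hz, rfl⟩ := Submodule.mem_sup.mp hx
  obtain ⟨q, rfl⟩ := Submodule.mem_span_singleton.mp hz
  obtain ⟨l, hl, rfl⟩ := (Finsupp.mem_span_image_iff_linearCombination ℚ).mp hy
  refine ⟨l.support, l, q, fun s hs => (Finsupp.mem_supported _ _).mp hl hs, ?_⟩
  simp [Finsupp.linearCombination_apply, Finsupp.sum, Rat.smul_def]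

theorem statement12 (p : ℕ) (hp : 0 < p) (n r : ℕ → ℕ)
    (h11 : ∀ i : ℕ, i + 1 < p → r (i + 1) + n (i + 1) + 1 ≤ r i)
    (P : MvPolynomial (Fin p) ℚ)
    (hdeg : ∀ i : Fin p, P.degreeOf i ≤ 3 * n i.1 + 1)
    (σ : Fin p → ℕ) (hσ : ∀ i, σ i = 2 ∨ σ i = 3)
    (hsym : ∀ i : Fin p, ∀ k : Fin p → ℚ,
      MvPolynomial.eval
          (Function.update k i (-(k i) - 2 * (r i.1 : ℚ) - (n i.1 : ℚ))) P
        = (-1 : ℚ) ^ (n i.1 + 1 + σ i) * MvPolynomial.eval k P) :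
    Summable (fun k : {k : Fin p → ℕ // Antitone k ∧ ∀ i, 1 ≤ k i} =>
        ((MvPolynomial.eval (fun i => (k.1 i : ℚ)) P : ℚ) : ℝ) /
          ∏ i : Fin p,
            ((ascPochhammer ℝ (n i.1 + 1)).eval ((k.1 i : ℝ) + (r i.1 : ℝ))) ^ 3) ∧
    ∃ (T : Finset (List ℕ)) (c : List ℕ → ℚ) (cₚ : ℚ),
      (∀ s ∈ T, s.length < p ∧ ∀ a ∈ s, a = 2 ∨ a = 3) ∧
      (∑' k : {k : Fin p → ℕ // Antitone k ∧ ∀ i, 1 ≤ k i},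
          ((MvPolynomial.eval (fun i => (k.1 i : ℚ)) P : ℚ) : ℝ) /
            ∏ i : Fin p,
              ((ascPochhammer ℝ (n i.1 + 1)).eval ((k.1 i : ℝ) + (r i.1 : ℝ))) ^ 3)
        = (∑ s ∈ T, (c s : ℝ) * mzv s) + (cₚ : ℝ) * mzv (List.ofFn σ) := by
  have hterm : ∀ k : Fin p → ℕ,
      ((MvPolynomial.eval (fun i => ((k i + 1 : ℕ) : ℚ)) P : ℚ) : ℝ) /
          ∏ i : Fin p,
            ((ascPochhammer ℝ (n i.1 + 1)).eval (((k i + 1 : ℕ) : ℝ) + (r i.1 : ℝ))) ^ 3 =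
        ∑ d ∈ P.support, ((P.coeff d / 2 ^ p : ℚ) : ℝ) *
          ∏ i : Fin p, symFactor (n i) (r i) (σ i) (d i) (k i) := by
    intro k
    have h := two_pow_mul_eval_of_symm P (fun i x => -x - 2 * (r i : ℚ) - n i)
      (fun i => (-1) ^ (n i + 1 + σ i)) (fun i => by rw [← mul_pow]; norm_num) hsym
      fun i => ((k i + 1 : ℕ) : ℚ)
    have h' : MvPolynomial.eval (fun i => ((k i + 1 : ℕ) : ℚ)) P = ∑ d ∈ P.support,
        P.coeff d / 2 ^ p * ∏ i, (((k i + 1 : ℕ) : ℚ) ^ d i + (-1) ^ (n i + 1 + σ i) *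
          (-((k i + 1 : ℕ) : ℚ) - 2 * (r i : ℚ) - n i) ^ d i) := by
      rw [eq_div_of_mul_eq (by positivity) ((mul_comm _ _).trans h), sum_div]
      exact sum_congr rfl fun d _ => by ring
    rw [h', Rat.cast_sum, sum_div]
    refine sum_congr rfl fun d _ => ?_
    simp only [symFactor, prod_div_distrib, ascPochhammer_eval_eq_prod]
    push_cast
    ring
  have hdeg' : ∀ d ∈ P.support, ∀ i : Fin p, d i ≤ 3 * n i + 1 := fun d hd i =>
    (MvPolynomial.monomial_le_degreeOf i hd).trans (hdeg i)
  have hsum : ∀ d ∈ P.support, Summable fun k : {k : Fin p → ℕ // Antitone k} =>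
      ((P.coeff d / 2 ^ p : ℚ) : ℝ) * ∏ i : Fin p, symFactor (n i) (r i) (σ i) (d i) (k.1 i) :=
    fun d hd => (summable_antitone _ fun i => summable_of_isBigO_nat (summable_shiftPow 0 2 le_rfl)
      (symFactor_isBigO _ _ _ _ (hdeg' d hd i))).mul_left _
  constructor
  · rw [← (antitoneEquivPos p).summable_iff]
    exact (summable_sum hsum).congr fun k => (hterm k.1).symm
  · refine exists_combination_of_mem ?_
    suffices hmem : ∑' k : {k : Fin p → ℕ // Antitone k}, ∑ d ∈ P.support,
        ((P.coeff d / 2 ^ p : ℚ) : ℝ) *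
          ∏ i : Fin p, symFactor (n i) (r i) (σ i) (d i) (k.1 i) ∈
        shortSpan p ⊔ Submodule.span ℚ {mzv (List.ofFn σ)} by
      convert hmem using 1
      exact ((antitoneEquivPos p).tsum_eq _).symm.trans (tsum_congr fun k => hterm k.1)
    rw [Summable.tsum_finsetSum hsum]
    refine Submodule.sum_mem _ fun d hd => ?_
    rw [tsum_mul_left, ← Rat.smul_def]
    exact Submodule.smul_mem _ _ (tsum_symFactor_mem p n r σ d h11 hσ (hdeg' d hd))
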